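/- (Quantitative hitting for the L-surface) Let 0 < α < 1 be badly approximable with all continued fraction digits a_i ≤ A. There is a constant C = 56(A+1)^{17}√2 such that for every k, any geodesic segment of slope 1/α and length M = 7(A+1)^{17} q_k √2 on the L-surface intersects every subinterval I of the union of the three horizontal edges with length(I) = 8/q_k; in particular M · length(I) = C is independent of k, and the geodesic is superdense. -/

import Mathlib

/-- `q_k`: the denominators of the continued fraction convergents of `α`. -/
noncomputable def cfq (α : ℝ) (k : ℕ) : ℝ := (GenContFract.of α).dens k

/-- `a_k`: the continued fraction digits (partial quotients) of `α`, for `k ≥ 1`. -/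
noncomputable def cfa (α : ℝ) (k : ℕ) : ℝ :=
  ((GenContFract.of α).partDens.get? (k - 1)).getD 0

/-- The interval exchange transformation T = T_α on [0,3) encoding the geodesic flow of slope
1/α on the L-surface: each of the six pieces is a translation. -/
noncomputable def TL (α : ℝ) (x : ℝ) : ℝ :=
  if x < 1 - α then x + 2 + α
  else if x < 1 then x + α
  else if x < 2 - α then x + α
  else if x < 2 then x + α
  else if x < 3 - α then x + α - 2
  else x + α - 3


/-! ### Finite combinatorics: permutations of the three squares and visited sets -/

/-- The six permutations of `Fin 3`: `g < 3` is a rotation, `g ≥ 3` a reflection. -/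
def lsAp (g : Fin 6) (l : Fin 3) : Fin 3 :=
  if g.val < 3 then Fin.ofNat 3 (g.val + l.val) else Fin.ofNat 3 (g.val + 3 - l.val)

/-- Composition: `lsMul h g` is `h` after `g`. -/
def lsMul (h g : Fin 6) : Fin 6 :=
  Fin.ofNat 6 ((if h.val < 3 then (h.val + g.val) % 3 else (h.val + 3 - g.val % 3) % 3) +
    (if (decide (h.val < 3)) = (decide (g.val < 3)) then 0 else 3))

def lsTst (v : Fin 8) (l : Fin 3) : Bool := v.val.testBit l.val

def lsOr (va vb : Fin 8) (g : Fin 6) : Fin 8 :=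
  Fin.ofNat 8 ((if lsTst va 0 || lsTst vb (lsAp g 0) then 1 else 0) +
    (if lsTst va 1 || lsTst vb (lsAp g 1) then 2 else 0) +
    (if lsTst va 2 || lsTst vb (lsAp g 2) then 4 else 0))

theorem lsAp_mul : ∀ h g : Fin 6, ∀ l : Fin 3, lsAp (lsMul h g) l = lsAp h (lsAp g l) := by
  decide +kernel

theorem lsAp_surj : ∀ g : Fin 6, ∀ l : Fin 3, ∃ l', lsAp g l' = l := by
  decide +kernel

theorem lsTst_or : ∀ va vb : Fin 8, ∀ g : Fin 6, ∀ l : Fin 3,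
    lsTst (lsOr va vb g) l = (lsTst va l || lsTst vb (lsAp g l)) := by
  decide +kernel

/-- A renormalization state: return permutations of the two pieces and the sets of squares
from which the return word of the piece visits the target. -/
structure LsSt where
  g : Fin 6
  h : Fin 6
  va : Fin 8
  vb : Fin 8

def LsSt.L (s : LsSt) : LsSt := ⟨s.g, lsMul s.h s.g, s.va, lsOr s.va s.vb s.g⟩
def LsSt.R (s : LsSt) : LsSt := ⟨lsMul s.h s.g, s.h, lsOr s.va s.vb s.g, s.vb⟩

def lsIn (X : ℕ) (s : LsSt) : Bool :=
  X.testBit (((s.g.val * 6 + s.h.val) * 8 + s.va.val) * 8 + s.vb.val)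

def lsX1 : ℕ := 18572361545903863813624057291063031938767144713860971976181747957276322779950338428800307648741058073729815634126016501574303653543817823906927941393481555406665406781690938823105840193322557763028676181651711649532778802827433695667445887623598017459458017040779184402706563476413740873593633691923193904621642181634306002569491738338063009503792105774424096411048066102249447082087494839038420797695985522077508498455939101932272806727928789233490458492874818751349934353911610723291057388479206848255435295817485733882376272953735763089019560377139327770687485982006147075079883549090884017472797842916630602951104157143384457948688285584976509801653553654058650173440
def lsX2 : ℕ := 101826331824217218086301195195581206778593290810353000835139739305743109118483392197680506149787401214729280088909128876290479284453875901374313705705331501354424230287103506331844653548876828922183523659435200564877395142652487899067701563931209604556591595236525151892999170621156658388574914485513385849276935829125689889534572011414110584850823218298184202884650257444021244173291941796644667977569117538192634934890973988160132899053116708169541335955421166123783443111843082528435519346739081582210320721312214771876029944720309002802655195213247861643569322602397555633165300620903777185775510620762046914735880114407348626730285516298225495560447958043694973642080256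
def lsX3 : ℕ := 185461437579570567230776291399771303520082448947880189203449451551582749819428059397966022997872383339511145640142547174231420457246364684052993880366012537643909314835835587908397376564053668029834883175979688279944176914195661954585724793183973450940604757528753867827139644883998147184293476880824702243212209136701459278687722466861168065017861507132497490386408858658541247865840216492269300848658108666220564393235294502015193094281025275090479941434529330234822818233046792448227954850342643276535498630847705516091300704127333330191140037460084676568276082045659214660279720319100815253950750865549768921702390358147322022330749436870897141019058849680948065759920128
def lsX4 : ℕ := 102024810078755389101763902981257649884552585463078055273909686880939193934114375371578184798814839915659047256352873990676550936889996367988283688631357105831604792564007660100950422440456821049708045065729384122969069349502017379529768325288274000137653269152614168089228532636717167402269696403911305625478180424360956984632751509837259608215242928591530681585554400421792376425735716012548466639588127056440694431167239519049727563785098304694697182226372796701305300129973504681555640276496474105446602317328863821849432319717431425862154473739714857130651226615860834480908028585388636503416786646514326320413925430081277822774128523311863540310426269908392551951368192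
def lsX5 : ℕ := 183839278496534951419003656932547943752573001609214702868329210121440889261603125325936328232901985470170664182588977860783018339988175442121720856456741231514416689996517536552362616889054013299488472374201502399146458212392272257518164529669592838651486109631849013262256508729281916920634551159049405840535588334520691134225961717679062035641158521177016391698473872922617437345229508242785124775392125847280894056840960540430503994432713719854107942797762024666442465564054012001991679302829668046166141703928483982561855137997790833135379911392545571002746641880592150571272628443642301233949295557746633472401624591465621576157882818214621856070084725813293284340006912
def lsX6 : ℕ := 101824772787951470936797357510780458506066820732434784975923389118444765956580037129703545973942917234992234692278623857184424276703614022408278815620467515074783731887488140275751368551372889491492764467945941013732247089793433112462382429249428038157839571267534801452200367572398053680467160347432941867176254939663296268838492295230009531206100603699055021627913805777041381869674889035188202447547296172996808613004180147484724164054998611029710680302880112327489313530798393765190330858344299841060019523580420584671663181737117722221605546581914821318119176073021460721061031118362210977939687474677698526875868658478268099687304494144517886346751302441581524826456064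
def lsX7 : ℕ := 101428567446364111127726155548991968966936507276021352233429937964406541683772589197705670885758345102648119952825426314505337202930095750269651286891070428771643977850398881270413584558413047814150126328937126625069254982402950482418698072037654547496162777729347997208428953890112060075640881801847924625724246053155012000904362654110787490406141360917943316085140937521179854286132816208678578366043721248422972470985438416596770610347682136109553354148514232008623155814592412746003990290765599352515874751083923887354627604606585575736095469295569207371347393058944942972067114384132557486212678453766682546426896760487893032664224735687772870209685931062474275054157824
def lsX8 : ℕ := 101428567446364111127726155548991968966936507276021352233429937964406541683772589197705670885758345102648119952825426314505337202930095750269651286891070428771643977850398881270413584558413047814150126328937126625069254982402950482418698072037654547496162777729347997208428953890112060075640881801847924625724246053155012000904362654110787490406141360917943316085140937521179854286132816208678578366043721248422972470985438416596770610347682136109553354148514232008623155814592412746003990290765599352515874751083923887354627604606585575736095469295569207371347393058944942972067114384132557486212678453766682546426896760487893032664224735687772870209685931062474275054157824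


theorem lsR_cl {X Y : ℕ}
    (h1 : ∀ g h : Fin 6, ∀ va vb : Fin 8, lsIn X ⟨g, h, va, vb⟩ = true →
      lsIn Y (LsSt.R ⟨g, h, va, vb⟩) = true)
    (h2 : ∀ g h : Fin 6, ∀ va vb : Fin 8, lsIn Y ⟨g, h, va, vb⟩ = true →
      lsIn Y (LsSt.R ⟨g, h, va, vb⟩) = true)
    (s : LsSt) (hs : lsIn X s = true) (c : ℕ) (hc : 1 ≤ c) : lsIn Y (LsSt.R^[c] s) = true := by
  induction c, hc using Nat.le_induction with
  | base => exact h1 _ _ _ _ hs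
  | succ n hn ih => rw [Function.iterate_succ_apply']; exact h2 _ _ _ _ ih

theorem lsL_cl {X Y : ℕ}
    (h1 : ∀ g h : Fin 6, ∀ va vb : Fin 8, lsIn X ⟨g, h, va, vb⟩ = true →
      lsIn Y (LsSt.L ⟨g, h, va, vb⟩) = true)
    (h2 : ∀ g h : Fin 6, ∀ va vb : Fin 8, lsIn Y ⟨g, h, va, vb⟩ = true →
      lsIn Y (LsSt.L ⟨g, h, va, vb⟩) = true)
    (s : LsSt) (hs : lsIn X s = true) (c : ℕ) (hc : 1 ≤ c) : lsIn Y (LsSt.L^[c] s) = true := by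
  induction c, hc using Nat.le_induction with
  | base => exact h1 _ _ _ _ hs
  | succ n hn ih => rw [Function.iterate_succ_apply']; exact h2 _ _ _ _ ih

theorem lsX0_initA : ∀ g h : Fin 6, ∀ l : Fin 3, lsMul g h ≠ lsMul h g →
    ∃ v, lsTst v l = true ∧ (∀ l', lsTst v l' = true → l' = l) ∧
      lsIn lsX1 (LsSt.R ⟨g, h, v, 0⟩) = true ∧ lsIn lsX1 (LsSt.R ⟨g, h, 0, v⟩) = true := by
  decide +kernel

theorem lsX1_cl : ∀ g h : Fin 6, ∀ va vb : Fin 8, lsIn lsX1 ⟨g, h, va, vb⟩ = true →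
      lsIn lsX1 (LsSt.R ⟨g, h, va, vb⟩) = true := by decide +kernel

theorem lsX8_full : ∀ g h : Fin 6, ∀ va vb : Fin 8, lsIn lsX8 ⟨g, h, va, vb⟩ = true →
      va = 7 ∧ vb = 7 := by decide +kernel

theorem lsX1_it (s : LsSt) (hs : lsIn lsX1 s.R = true) (c : ℕ) (hc : 1 ≤ c) :
    lsIn lsX1 (LsSt.R^[c] s) = true := by
  induction c, hc using Nat.le_induction with
  | base => exact hs
  | succ n hn ih => rw [Function.iterate_succ_apply']; exact lsX1_cl _ _ _ _ ih

theorem lsFull (s : LsSt) (hs : lsIn lsX1 s.R = true) (c : ℕ → ℕ) (hc : ∀ i, 1 ≤ c i) :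
    (LsSt.L^[c 7] (LsSt.R^[c 6] (LsSt.L^[c 5] (LsSt.R^[c 4] (LsSt.L^[c 3] (LsSt.R^[c 2]
      (LsSt.L^[c 1] (LsSt.R^[c 0] s)))))))).va = 7 ∧
    (LsSt.L^[c 7] (LsSt.R^[c 6] (LsSt.L^[c 5] (LsSt.R^[c 4] (LsSt.L^[c 3] (LsSt.R^[c 2]
      (LsSt.L^[c 1] (LsSt.R^[c 0] s)))))))).vb = 7 := by
  have x1 := lsX1_it s hs (c 0) (hc 0)
  have x2 := lsL_cl (Y := lsX2) (by decide +kernel) (by decide +kernel) _ x1 (c 1) (hc 1)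
  have x3 := lsR_cl (Y := lsX3) (by decide +kernel) (by decide +kernel) _ x2 (c 2) (hc 2)
  have x4 := lsL_cl (Y := lsX4) (by decide +kernel) (by decide +kernel) _ x3 (c 3) (hc 3)
  have x5 := lsR_cl (Y := lsX5) (by decide +kernel) (by decide +kernel) _ x4 (c 4) (hc 4)
  have x6 := lsL_cl (Y := lsX6) (by decide +kernel) (by decide +kernel) _ x5 (c 5) (hc 5)
  have x7 := lsR_cl (Y := lsX7) (by decide +kernel) (by decide +kernel) _ x6 (c 6) (hc 6)
  have x8 := lsL_cl (Y := lsX8) (by decide +kernel) (by decide +kernel) _ x7 (c 7) (hc 7)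
  exact lsX8_full _ _ _ _ x8

theorem lsNC_R : ∀ g h : Fin 6, lsMul g h ≠ lsMul h g →
    lsMul (lsMul h g) h ≠ lsMul h (lsMul h g) := by decide +kernel
theorem lsNC_L : ∀ g h : Fin 6, lsMul g h ≠ lsMul h g →
    lsMul g (lsMul h g) ≠ lsMul (lsMul h g) g := by decide +kernel

def LsSt.NC (s : LsSt) : Prop := lsMul s.g s.h ≠ lsMul s.h s.g

theorem lsNC_Ri (s : LsSt) (hs : s.NC) (c : ℕ) : (LsSt.R^[c] s).NC := by
  induction c with
  | zero => exact hs
  | succ n ih => rw [Function.iterate_succ_apply']; exact lsNC_R _ _ ih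

theorem lsNC_Li (s : LsSt) (hs : s.NC) (c : ℕ) : (LsSt.L^[c] s).NC := by
  induction c with
  | zero => exact hs
  | succ n ih => rw [Function.iterate_succ_apply']; exact lsNC_L _ _ ih

/-! ### Continued fraction data -/

theorem lsCF (α : ℝ) (hα : Irrational α) (h0 : 0 < α) (h1 : α < 1) :
    ∃ (d q : ℕ → ℕ) (θ : ℕ → ℝ), (∀ k, 1 ≤ d k) ∧ (∀ k, cfa α (k + 1) = d k) ∧
      q 0 = 1 ∧ q 1 = d 0 ∧ (∀ k, q (k + 2) = d (k + 1) * q (k + 1) + q k) ∧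
      (∀ k, cfq α k = q k) ∧ θ 0 = 1 ∧ θ 1 = α ∧ (∀ k, θ (k + 2) = θ k - d k * θ (k + 1)) ∧
      (∀ k, 0 < θ k) := by
  let f : ℕ → ℝ := fun n => Nat.rec α (fun _ x => Int.fract x⁻¹) n
  have f0 : f 0 = α := rfl
  have fs : ∀ n, f (n + 1) = Int.fract (f n)⁻¹ := fun n => rfl
  have firr : ∀ n, Irrational (f n) := by
    intro n
    induction n with
    | zero => exact hα
    | succ n ih => rw [fs, Int.fract]; exact ih.inv.sub_intCast _
  have fpos : ∀ n, 0 < f n := by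
    intro n
    cases n with
    | zero => exact h0
    | succ n => exact lt_of_le_of_ne (Int.fract_nonneg _) (firr (n + 1)).ne_zero.symm
  have flt : ∀ n, f n < 1 := by
    intro n
    cases n with
    | zero => exact h1
    | succ n => exact Int.fract_lt_one _
  have fstr : ∀ n, ∃ b, GenContFract.IntFractPair.stream α n = some ⟨b, f n⟩ := by
    intro n
    induction n with
    | zero =>
      refine ⟨⌊α⌋, ?_⟩
      rw [GenContFract.IntFractPair.stream_zero, GenContFract.IntFractPair.of, f0,
        Int.fract_eq_self.2 ⟨h0.le, h1⟩]
    | succ n ih =>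
      obtain ⟨b, hb⟩ := ih
      exact ⟨_, GenContFract.IntFractPair.stream_succ_of_some hb (fpos n).ne'⟩
  let d : ℕ → ℕ := fun n => ⌊(f n)⁻¹⌋₊
  have dcast : ∀ n, ((⌊(f n)⁻¹⌋ : ℤ) : ℝ) = (d n : ℝ) := by
    intro n
    exact (natCast_floor_eq_intCast_floor (inv_pos.2 (fpos n)).le).symm
  have hget : ∀ n, (GenContFract.of α).s.get? n = some ⟨1, (d n : ℝ)⟩ := by
    intro n
    obtain ⟨b, hb⟩ := fstr n
    rw [GenContFract.get?_of_eq_some_of_get?_intFractPair_stream_fr_ne_zero hb (fpos n).ne',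
      ← dcast n]
    rfl
  have hd1 : ∀ k, 1 ≤ d k := by
    intro k
    apply Nat.le_floor
    rw [Nat.cast_one]
    exact (one_lt_inv₀ (fpos k)).2 (flt k) |>.le
  let qq : ℕ → ℕ × ℕ := fun n => Nat.rec (1, d 0) (fun k p => (p.2, d (k + 1) * p.2 + p.1)) n
  let q : ℕ → ℕ := fun n => (qq n).1
  have q2 : ∀ k, q (k + 2) = d (k + 1) * q (k + 1) + q k := fun k => rfl
  have hq : ∀ k, cfq α k = q k ∧ cfq α (k + 1) = q (k + 1) := by
    intro k
    induction k with
    | zero =>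
      refine ⟨?_, ?_⟩
      · simp [cfq, q, qq]
      · rw [cfq, GenContFract.first_den_eq (hget 0)]
        rfl
    | succ k ih =>
      refine ⟨ih.2, ?_⟩
      rw [cfq, GenContFract.dens_recurrence (hget (k + 1)) ih.1 ih.2, q2]
      push_cast
      ring
  let θ : ℕ → ℝ := fun n => Nat.rec 1 (fun k x => f k * x) n
  have θs : ∀ n, θ (n + 1) = f n * θ n := fun n => rfl
  refine ⟨d, q, θ, hd1, ?_, rfl, rfl, q2, fun k => (hq k).1, rfl, ?_, ?_, ?_⟩
  · intro k
    simp [cfa, GenContFract.partDen_eq_s_b (hget k)]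
  · exact mul_one α
  · intro k
    have e : f (k + 1) = (f k)⁻¹ - d k := by rw [fs, Int.fract, dcast]
    rw [show θ (k + 2) = f (k + 1) * θ (k + 1) from rfl, e, θs]
    have := (fpos k).ne'
    field_simp
  · intro k
    induction k with
    | zero => exact one_pos
    | succ k ih => rw [θs]; exact mul_pos (fpos k) ih

/-! ### Rokhlin towers under Euclidean renormalization -/

/-- `z` lies on the floor of height `i < s` above the piece `[u, v)` of square `l`. -/
def LsFl (α u v : ℝ) (s : ℕ) (z : ℝ) : Prop :=
  ∃ (x : ℝ) (l : Fin 3) (i : ℕ), u ≤ x ∧ x < v ∧ i < s ∧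
    ∀ x', u ≤ x' → x' < v → (TL α)^[i] (x' + (l.val : ℝ)) = z + x' - x

/-- Two-tower structure over `[0, a + b)`, with target interval `[c, e)`. -/
structure LsTw (α c e a b : ℝ) (s t : ℕ) (st : LsSt) : Prop where
  ha : 0 < a
  hb : 0 < b
  retA : ∀ (x : ℝ) (l : Fin 3), 0 ≤ x → x < a →
    (TL α)^[s] (x + (l.val : ℝ)) = x + b + ((lsAp st.g l).val : ℝ)
  retB : ∀ (x : ℝ) (l : Fin 3), a ≤ x → x < a + b →
    (TL α)^[t] (x + (l.val : ℝ)) = x - a + ((lsAp st.h l).val : ℝ)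
  cov : ∀ z : ℝ, 0 ≤ z → z < 3 → LsFl α 0 a s z ∨ LsFl α a (a + b) t z
  visA : ∀ (l : Fin 3), lsTst st.va l = true → ∀ x : ℝ, 0 ≤ x → x < a →
    ∃ i < s, (TL α)^[i] (x + (l.val : ℝ)) ∈ Set.Ico c e
  visB : ∀ (l : Fin 3), lsTst st.vb l = true → ∀ x : ℝ, a ≤ x → x < a + b →
    ∃ i < t, (TL α)^[i] (x + (l.val : ℝ)) ∈ Set.Ico c e

theorem lsTst_zero : ∀ l : Fin 3, lsTst 0 l = false := by decide
theorem lsTst_seven : ∀ l : Fin 3, lsTst 7 l = true := by decide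

theorem lsBase (α c e : ℝ) (h0 : 0 < α) (h1 : α < 1) :
    LsTw α c e (1 - α) α 1 1 ⟨5, 1, 0, 0⟩ where
  ha := by linarith
  hb := h0
  retA := by
    intro x l hx hx'
    have e0 : lsAp 5 0 = 2 := by decide
    have e1 : lsAp 5 1 = 1 := by decide
    have e2 : lsAp 5 2 = 0 := by decide
    fin_cases l
    · simp only [Fin.zero_eta, e0, Function.iterate_one, TL]
      norm_num
      rw [if_pos hx']; ring
    · simp only [Fin.mk_one, e1, Function.iterate_one, TL]
      norm_num
      rw [if_neg (by linarith), if_neg (by linarith), if_pos (by linarith)]; ring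
    · simp only [Fin.reduceFinMk, e2, Function.iterate_one, TL]
      norm_num
      rw [if_neg (by linarith), if_neg (by linarith), if_neg (by linarith), if_neg (by linarith),
        if_pos (by linarith)]; ring
  retB := by
    intro x l hx hx'
    have e0 : lsAp 1 0 = 1 := by decide
    have e1 : lsAp 1 1 = 2 := by decide
    have e2 : lsAp 1 2 = 0 := by decide
    fin_cases l
    · simp only [Fin.zero_eta, e0, Function.iterate_one, TL]
      norm_num
      rw [if_neg (by linarith), if_pos (by linarith)]; ring
    · simp only [Fin.mk_one, e1, Function.iterate_one, TL]
      norm_num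
      rw [if_neg (by linarith), if_neg (by linarith), if_neg (by linarith), if_pos (by linarith)]
      ring
    · simp only [Fin.reduceFinMk, e2, Function.iterate_one, TL]
      norm_num
      rw [if_neg (by linarith), if_neg (by linarith), if_neg (by linarith), if_neg (by linarith),
        if_neg (by linarith)]; ring
  cov := by
    intro z hz hz'
    have key : ∀ l : Fin 3, (l.val : ℝ) ≤ z → z < (l.val : ℝ) + 1 →
        LsFl α 0 (1 - α) 1 z ∨ LsFl α (1 - α) (1 - α + α) 1 z := by
      intro l hl hl'
      rcases lt_or_ge (z - (l.val : ℝ)) (1 - α) with h | h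
      · refine Or.inl ⟨z - (l.val : ℝ), l, 0, by linarith, h, one_pos, ?_⟩
        intro x' _ _
        rw [Function.iterate_zero, id]; ring
      · refine Or.inr ⟨z - (l.val : ℝ), l, 0, by linarith, by linarith, one_pos, ?_⟩
        intro x' _ _
        rw [Function.iterate_zero, id]; ring
    rcases lt_or_ge z 1 with h | h
    · exact key 0 (by simpa using hz) (by simpa using h)
    rcases lt_or_ge z 2 with h' | h'
    · exact key 1 (by simpa using h) (by norm_num; linarith)
    · exact key 2 (by simpa using h') (by norm_num; linarith)
  visA := by
    intro l hl
    rw [lsTst_zero] at hl; cases hl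
  visB := by
    intro l hl
    rw [lsTst_zero] at hl; cases hl

theorem LsTw.stepL {α c e a b : ℝ} {s t : ℕ} {st : LsSt} (T : LsTw α c e a b s t st)
    (hab : b < a) : LsTw α c e (a - b) b s (t + s) st.L where
  ha := by linarith
  hb := T.hb
  retA := by
    intro x l hx hx'
    exact T.retA x l hx (by linarith [T.hb])
  retB := by
    intro x l hx hx'
    have hb := T.hb
    rw [Function.iterate_add_apply, T.retA x l (by linarith) (by linarith),
      T.retB (x + b) _ (by linarith) (by linarith)]
    simp only [LsSt.L, lsAp_mul]
    ring
  cov := by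
    intro z hz hz'
    have hb := T.hb
    rcases T.cov z hz hz' with ⟨x, l, i, hx, hx', hi, hf⟩ | ⟨x, l, i, hx, hx', hi, hf⟩
    · rcases lt_or_ge x (a - b) with h | h
      · exact Or.inl ⟨x, l, i, hx, h, hi, fun x' h1 h2 => hf x' h1 (by linarith)⟩
      · exact Or.inr ⟨x, l, i, h, by linarith, by omega,
          fun x' h1 h2 => hf x' (by linarith) (by linarith)⟩
    · obtain ⟨l', hl'⟩ := lsAp_surj st.g l
      refine Or.inr ⟨x - b, l', i + s, by linarith, by linarith, by omega, ?_⟩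
      intro x' h1 h2
      rw [Function.iterate_add_apply, T.retA x' l' (by linarith) (by linarith), hl',
        hf (x' + b) (by linarith) (by linarith)]
      ring
  visA := by
    intro l hl x hx hx'
    exact T.visA l hl x hx (by linarith [T.hb])
  visB := by
    intro l hl x hx hx'
    have hb := T.hb
    simp only [LsSt.L, lsTst_or, Bool.or_eq_true] at hl
    rcases hl with hl | hl
    · obtain ⟨i, hi, h⟩ := T.visA l hl x (by linarith) (by linarith)
      exact ⟨i, by omega, h⟩
    · obtain ⟨i, hi, h⟩ := T.visB _ hl (x + b) (by linarith) (by linarith)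
      refine ⟨i + s, by omega, ?_⟩
      rwa [Function.iterate_add_apply, T.retA x l (by linarith) (by linarith)]

theorem LsTw.stepR {α c e a b : ℝ} {s t : ℕ} {st : LsSt} (T : LsTw α c e a b s t st)
    (hab : a < b) : LsTw α c e a (b - a) (t + s) t st.R where
  ha := T.ha
  hb := by linarith
  retA := by
    intro x l hx hx'
    rw [Function.iterate_add_apply, T.retA x l (by linarith) (by linarith),
      T.retB (x + b) _ (by linarith) (by linarith)]
    simp only [LsSt.R, lsAp_mul]
    ring
  retB := by
    intro x l hx hx'
    exact T.retB x l hx (by linarith [T.ha])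
  cov := by
    intro z hz hz'
    have ha := T.ha
    rcases T.cov z hz hz' with ⟨x, l, i, hx, hx', hi, hf⟩ | ⟨x, l, i, hx, hx', hi, hf⟩
    · exact Or.inl ⟨x, l, i, hx, hx', by omega, hf⟩
    · rcases lt_or_ge x b with h | h
      · exact Or.inr ⟨x, l, i, hx, by linarith, hi,
          fun x' h1 h2 => hf x' (by linarith) (by linarith)⟩
      · obtain ⟨l', hl'⟩ := lsAp_surj st.g l
        refine Or.inl ⟨x - b, l', i + s, by linarith, by linarith, by omega, ?_⟩
        intro x' h1 h2
        rw [Function.iterate_add_apply, T.retA x' l' (by linarith) (by linarith), hl',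
          hf (x' + b) (by linarith) (by linarith)]
        ring
  visA := by
    intro l hl x hx hx'
    simp only [LsSt.R, lsTst_or, Bool.or_eq_true] at hl
    rcases hl with hl | hl
    · obtain ⟨i, hi, h⟩ := T.visA l hl x (by linarith) (by linarith)
      exact ⟨i, by omega, h⟩
    · obtain ⟨i, hi, h⟩ := T.visB _ hl (x + b) (by linarith) (by linarith)
      refine ⟨i + s, by omega, ?_⟩
      rwa [Function.iterate_add_apply, T.retA x l (by linarith) (by linarith)]
  visB := by
    intro l hl x hx hx'
    exact T.visB l hl x hx (by linarith [T.ha])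

theorem LsTw.runL {α c e a b : ℝ} {s t : ℕ} {st : LsSt} (T : LsTw α c e a b s t st) (n : ℕ)
    (hab : 0 < a - n * b) : LsTw α c e (a - n * b) b s (t + n * s) (LsSt.L^[n] st) := by
  induction n with
  | zero => simpa using T
  | succ n ih =>
    push_cast at hab
    have hb := T.hb
    have := (ih (by linarith)).stepL (by linarith)
    rw [Function.iterate_succ_apply']
    convert this using 1
    · push_cast; ring
    · ring

theorem LsTw.runR {α c e a b : ℝ} {s t : ℕ} {st : LsSt} (T : LsTw α c e a b s t st) (n : ℕ)
    (hab : 0 < b - n * a) : LsTw α c e a (b - n * a) (s + n * t) t (LsSt.R^[n] st) := by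
  induction n with
  | zero => simpa using T
  | succ n ih =>
    push_cast at hab
    have ha := T.ha
    have := (ih (by linarith)).stepR (by linarith)
    rw [Function.iterate_succ_apply']
    convert this using 1
    · push_cast; ring
    · ring

/-- Once both return words visit the target from every square, every orbit hits it quickly. -/
theorem LsTw.hit {α c e a b : ℝ} {s t : ℕ} {st : LsSt} (T : LsTw α c e a b s t st)
    (hst : s ≤ t) (hva : st.va = 7) (hvb : st.vb = 7) (z : ℝ) (hz : 0 ≤ z) (hz' : z < 3) :
    ∃ N, N + 1 ≤ 2 * t ∧ (TL α)^[N] z ∈ Set.Ico c e := by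
  have ha := T.ha
  have hb := T.hb
  have key : ∀ x : ℝ, 0 ≤ x → x < a + b → ∀ l : Fin 3,
      ∃ i < t, (TL α)^[i] (x + (l.val : ℝ)) ∈ Set.Ico c e := by
    intro x hx hx' l
    rcases lt_or_ge x a with h | h
    · obtain ⟨i, hi, hh⟩ := T.visA l (by rw [hva]; exact lsTst_seven l) x hx h
      exact ⟨i, by omega, hh⟩
    · exact T.visB l (by rw [hvb]; exact lsTst_seven l) x h hx'
  rcases T.cov z hz hz' with ⟨x, l, i, hx, hx', hi, hf⟩ | ⟨x, l, i, hx, hx', hi, hf⟩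
  · have e1 := hf x hx hx'
    have e2 := T.retA x l hx hx'
    rw [show s = (s - i) + i by omega, Function.iterate_add_apply, e1] at e2
    obtain ⟨j, hj, hh⟩ := key (x + b) (by linarith) (by linarith) (lsAp st.g l)
    refine ⟨j + (s - i), by omega, ?_⟩
    rw [Function.iterate_add_apply, show z = z + x - x by ring, e2]
    exact hh
  · have e1 := hf x hx hx'
    have e2 := T.retB x l hx hx'
    rw [show t = (t - i) + i by omega, Function.iterate_add_apply, e1] at e2
    obtain ⟨j, hj, hh⟩ := key (x - a) (by linarith) (by linarith) (lsAp st.h l)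
    refine ⟨j + (t - i), by omega, ?_⟩
    rw [Function.iterate_add_apply, show z = z + x - x by ring, e2]
    exact hh

/-- Marking the target floor. -/
theorem LsTw.mark {α c e a b w z : ℝ} {s t : ℕ} {st : LsSt} (T : LsTw α c e a b s t st)
    (hNC : st.NC) (ha : a ≤ w) (hb : b ≤ w) (hz : 0 ≤ z) (hz' : z < 3) (hc : c ≤ z - w)
    (he : z + w ≤ e) :
    ∃ st', LsTw α c e a b s t st' ∧ lsIn lsX1 st'.R = true := by
  rcases T.cov z hz hz' with ⟨x, l, i, hx, hx', hi, hf⟩ | ⟨x, l, i, hx, hx', hi, hf⟩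
  · obtain ⟨v, -, hv, hin, -⟩ := lsX0_initA st.g st.h l hNC
    refine ⟨⟨st.g, st.h, v, 0⟩, ⟨T.ha, T.hb, T.retA, T.retB, T.cov, ?_, ?_⟩, hin⟩
    · intro l' hl' x' h1 h2
      rw [hv l' hl']
      refine ⟨i, hi, ?_⟩
      rw [hf x' h1 h2]
      constructor <;> linarith
    · intro l hl
      rw [lsTst_zero] at hl; cases hl
  · obtain ⟨v, -, hv, -, hin⟩ := lsX0_initA st.g st.h l hNC
    refine ⟨⟨st.g, st.h, 0, v⟩, ⟨T.ha, T.hb, T.retA, T.retB, T.cov, ?_, ?_⟩, hin⟩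
    · intro l hl
      rw [lsTst_zero] at hl; cases hl
    · intro l' hl' x' h1 h2
      rw [hv l' hl']
      refine ⟨i, hi, ?_⟩
      rw [hf x' h1 h2]
      constructor <;> linarith

theorem lsMain (α A : ℝ) (hα : Irrational α) (h0 : 0 < α) (h1 : α < 1)
    (hbad : ∀ i : ℕ, 1 ≤ i → cfa α i ≤ A) (k : ℕ) (hk : 1 ≤ k) (c : ℝ) (hc : 0 ≤ c)
    (hc3 : c + 8 / cfq α k ≤ 3) (z : ℝ) (hz : 0 ≤ z) (hz' : z < 3) :
    ∃ N : ℕ, ((N + 1 : ℕ) : ℝ) ≤ 7 * (A + 1) ^ 17 * cfq α k ∧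
      (TL α)^[N] z ∈ Set.Ico c (c + 8 / cfq α k) := by
  obtain ⟨d, q, θ, hd, hda, q0, q1, q2, hq, θ0, θ1, θ2, θpos⟩ := lsCF α hα h0 h1
  have hdA : ∀ n, (d n : ℝ) ≤ A := fun n => by
    rw [← hda]; exact hbad (n + 1) (by omega)
  have hA : 1 ≤ A := le_trans (by exact_mod_cast hd 0) (hdA 0)
  have qmono1 : ∀ n, q n ≤ q (n + 1) := by
    intro n
    cases n with
    | zero => rw [q0, q1]; exact hd 0
    | succ n =>
      rw [q2]
      have := Nat.mul_le_mul_right (q (n + 1)) (hd (n + 1))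
      omega
  have qmono : Monotone q := monotone_nat_of_le_succ qmono1
  have qpos : ∀ n, 1 ≤ q n := fun n => q0 ▸ qmono (Nat.zero_le n)
  have qA1 : ∀ n, (q (n + 1) : ℝ) ≤ (A + 1) * q n := by
    intro n
    cases n with
    | zero => rw [q0, q1]; have := hdA 0; push_cast; linarith
    | succ n =>
      rw [q2]
      push_cast
      have e1 : (q n : ℝ) ≤ q (n + 1) := by exact_mod_cast qmono1 n
      have e2 : (d (n + 1) : ℝ) * q (n + 1) ≤ A * q (n + 1) :=
        mul_le_mul_of_nonneg_right (hdA _) (Nat.cast_nonneg _)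
      linarith
  have qA : ∀ r n, (q (n + r) : ℝ) ≤ (A + 1) ^ r * q n := by
    intro r n
    induction r with
    | zero => simp
    | succ r ih =>
      calc (q (n + r + 1) : ℝ) ≤ (A + 1) * q (n + r) := qA1 _
        _ ≤ (A + 1) * ((A + 1) ^ r * q n) := mul_le_mul_of_nonneg_left ih (by linarith)
        _ = _ := by ring
  have θdec : ∀ n, θ (n + 2) < θ (n + 1) := by
    intro n
    have e1 := θ2 (n + 1)
    have e2 := θpos (n + 1 + 2)
    have e3 : (1 : ℝ) ≤ d (n + 1) := by exact_mod_cast hd (n + 1)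
    have e4 : θ (n + 2) ≤ d (n + 1) * θ (n + 2) := by nlinarith [θpos (n + 2)]
    have e5 : θ (n + 1 + 1) = θ (n + 2) := rfl
    rw [e5] at e1
    linarith
  have area : ∀ n, (q (n + 1) : ℝ) * θ (n + 1) + q n * θ (n + 2) = 1 := by
    intro n
    induction n with
    | zero => rw [θ2, θ0, θ1, q0, q1]; push_cast; ring
    | succ n ih =>
      have e1 := θ2 (n + 1)
      rw [show n + 1 + 2 = n + 3 from rfl, show n + 1 + 1 = n + 2 from rfl] at *
      rw [e1, q2]
      push_cast
      linarith
  have θle : ∀ n, θ (n + 1) ≤ 1 / q (n + 1) := by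
    intro n
    have p : (0 : ℝ) < q (n + 1) := by exact_mod_cast qpos (n + 1)
    rw [le_div_iff₀ p]
    have := area n
    have : 0 ≤ (q n : ℝ) * θ (n + 2) := mul_nonneg (Nat.cast_nonneg _) (θpos _).le
    linarith
  set e := c + 8 / cfq α k with he
  have pair : ∀ n st, LsTw α c e (θ (n + 2)) (θ (n + 1)) (q n) (q (n + 1)) st →
      LsTw α c e (θ (n + 4)) (θ (n + 3)) (q (n + 2)) (q (n + 3))
        (LsSt.L^[d (n + 2)] (LsSt.R^[d (n + 1)] st)) := by
    intro n st T
    have e1 : θ (n + 3) = θ (n + 1) - d (n + 1) * θ (n + 2) := θ2 (n + 1)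
    have e2 : θ (n + 4) = θ (n + 2) - d (n + 2) * θ (n + 3) := θ2 (n + 2)
    have T1 := T.runR (d (n + 1)) (by rw [← e1]; exact θpos _)
    rw [← e1, show q n + d (n + 1) * q (n + 1) = q (n + 2) by rw [q2]; ring] at T1
    have T2 := T1.runL (d (n + 2)) (by rw [← e2]; exact θpos _)
    rwa [← e2, show q (n + 1) + d (n + 2) * q (n + 2) = q (n + 3) by
      have e3 : q (n + 3) = d (n + 2) * q (n + 2) + q (n + 1) := q2 (n + 1)
      rw [e3, add_comm]] at T2
  have stage : ∀ j, ∃ st, st.NC ∧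
      LsTw α c e (θ (2 * j + 2)) (θ (2 * j + 1)) (q (2 * j)) (q (2 * j + 1)) st := by
    intro j
    induction j with
    | zero =>
      refine ⟨LsSt.L^[d 0 - 1] ⟨5, 1, 0, 0⟩, lsNC_Li _ (by unfold LsSt.NC; decide) _, ?_⟩
      have hd0 : ((d 0 - 1 : ℕ) : ℝ) = d 0 - 1 := by rw [Nat.cast_sub (hd 0)]; simp
      have e1 : θ 2 = 1 - α - ((d 0 - 1 : ℕ) : ℝ) * α := by
        rw [hd0, θ2 0, θ0, θ1]; ring
      have T := (lsBase α c e h0 h1).runL (d 0 - 1) (by rw [← e1]; exact θpos _)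
      rw [← e1] at T
      have e2 : 1 + (d 0 - 1) * 1 = d 0 := by have := hd 0; omega
      rw [e2] at T
      simpa [θ1, q0, q1] using T
    | succ j ih =>
      obtain ⟨st, hN, T⟩ := ih
      exact ⟨_, lsNC_Li _ (lsNC_Ri _ hN _) _, pair _ _ T⟩
  obtain ⟨st, hNC, T⟩ := stage (k / 2)
  set n := 2 * (k / 2) with hn
  have hnk : k ≤ n + 1 := by omega
  have hnk' : n ≤ k := by omega
  have qkpos : (0 : ℝ) < q k := by exact_mod_cast qpos k
  have w1 : θ (n + 1) ≤ 1 / q k := (θle n).trans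
    (one_div_le_one_div_of_le qkpos (by exact_mod_cast qmono hnk))
  have w2 : θ (n + 2) ≤ 1 / q k := (θdec n).le.trans w1
  have hinv : 0 < 1 / (q k : ℝ) := by positivity
  have h8 : (8 : ℝ) / q k = 8 * (1 / q k) := by ring
  rw [hq, h8] at he
  rw [hq]
  obtain ⟨st', T', hin⟩ := T.mark (w := 1 / q k) (z := c + 4 * (1 / q k)) hNC w2 w1
    (by linarith) (by linarith) (by linarith) (by linarith)
  have T4 := pair _ _ (pair _ _ (pair _ _ (pair _ _ T')))
  obtain ⟨f1, f2⟩ := lsFull st' hin (fun i => d (n + 1 + i)) (fun i => hd _)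
  obtain ⟨N, hN, hit⟩ := T4.hit (qmono1 _) f1 f2 z hz hz'
  refine ⟨N, ?_, hit⟩
  have b1 : ((N + 1 : ℕ) : ℝ) ≤ 2 * q (k + 9) := by
    have : q (n + 2 + 2 + 2 + 3) ≤ q (k + 9) := qmono (by omega)
    have h' : N + 1 ≤ 2 * q (k + 9) := by
      refine hN.trans (Nat.mul_le_mul_left 2 ?_)
      exact qmono (by omega)
    exact_mod_cast h'
  have b2 := qA 9 k
  have b3 : (A + 1) ^ 9 ≤ (A + 1) ^ 17 := pow_le_pow_right₀ (by linarith) (by norm_num)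
  have b4 : 0 ≤ (A + 1) ^ 9 := by positivity
  have b5 : (A + 1) ^ 9 * q k ≤ (A + 1) ^ 17 * q k := mul_le_mul_of_nonneg_right b3 qkpos.le
  have b6 : 0 ≤ (A + 1) ^ 17 * q k := by positivity
  nlinarith

/-- Quantitative hitting for the L-surface: let 0 < α < 1 be badly approximable with all
continued fraction digits ≤ A.  A half-infinite geodesic of slope 1/α on the L-surface is
encoded by its successive crossing points y_1, y_2, ... of the three horizontal edges
(identified with [0,3)), which form an orbit of the interval exchange T_α; consecutive
crossings are a time √(1+α²) apart.  Then for every k, the geodesic segment of length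
M = 7(A+1)^{17} q_k √2 intersects every subinterval I ⊆ [0,3) with length(I) = 8/q_k; in
particular M · length(I) = 56(A+1)^{17}√2 is independent of k, so the geodesic is superdense. -/
theorem stmt18 (α A : ℝ) (hα : Irrational α) (h0 : 0 < α) (h1 : α < 1)
    (hbad : ∀ i : ℕ, 1 ≤ i → cfa α i ≤ A)
    (y : ℕ → ℝ)
    (hy : ∀ i, 1 ≤ i → y i ∈ Set.Ico (0 : ℝ) 3)
    (horb : ∀ i, 1 ≤ i → TL α (y i) = y (i + 1)) :
    ∀ k : ℕ, 1 ≤ k → ∀ c : ℝ, 0 ≤ c → c + 8 / cfq α k ≤ 3 →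
      ∃ i : ℕ, 1 ≤ i ∧
        (i : ℝ) * Real.sqrt (1 + α ^ 2) ≤ 7 * (A + 1) ^ 17 * cfq α k * Real.sqrt 2 ∧
        y i ∈ Set.Ico c (c + 8 / cfq α k) := by
  intro k hk c hc hc3
  have hz := hy 1 le_rfl
  obtain ⟨N, hN, hit⟩ := lsMain α A hα h0 h1 hbad k hk c hc hc3 (y 1) hz.1 hz.2
  have orb : ∀ n, (TL α)^[n] (y 1) = y (n + 1) := by
    intro n
    induction n with
    | zero => rfl
    | succ n ih => rw [Function.iterate_succ_apply', ih]; exact horb (n + 1) (by omega)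
  refine ⟨N + 1, by omega, ?_, by rw [← orb]; exact hit⟩
  have hs : Real.sqrt (1 + α ^ 2) ≤ Real.sqrt 2 := Real.sqrt_le_sqrt (by nlinarith)
  calc ((N + 1 : ℕ) : ℝ) * Real.sqrt (1 + α ^ 2)
      ≤ ((N + 1 : ℕ) : ℝ) * Real.sqrt 2 := mul_le_mul_of_nonneg_left hs (Nat.cast_nonneg _)
    _ ≤ _ := mul_le_mul_of_nonneg_right hN (Real.sqrt_nonneg _)
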